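/- Let Ω = { x ∈ ℝ⁴ : x₄ > √(x₁²+x₂²+x₃²) }, write r² = x₁²+x₂²+x₃² and τ² = x₄² − r², and define the (normalized) Morawetz vector field U(x) = ( 2x₄x₁, 2x₄x₂, 2x₄x₃, x₄² + r² ) / (x₄² − r²). Then η(U,U) = −1 on Ω, and the triple (U, ρ, p) with ρ(x) = (x₄² − r²)^{−4} and p = ρ/3 (radiation equation of state) satisfies both the relativistic Euler equations and the energy conservation equation along flow lines on Ω. -/

import Mathlib

open scoped BigOperators

noncomputable section

/-- Coefficients of the Minkowski metric `diag(1,1,1,−1)`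
(the fourth coordinate, index `3`, is timelike). -/
def etaCoef : Fin 4 → ℝ := fun μ => if μ = 3 then -1 else 1

/-- The Minkowski bilinear form on `ℝ⁴`: `η(v,w) = v₁w₁ + v₂w₂ + v₃w₃ − v₄w₄`. -/
def eta (v w : Fin 4 → ℝ) : ℝ := ∑ μ, etaCoef μ * v μ * w μ

/-- The components `η_{μν} = diag(1,1,1,−1)` of the Minkowski metric. -/
def etaMat (μ ν : Fin 4) : ℝ := if μ = ν then etaCoef μ else 0

/-- The partial derivative `∂_μ f (x)`. -/
def pd (μ : Fin 4) (f : (Fin 4 → ℝ) → ℝ) (x : Fin 4 → ℝ) : ℝ :=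
  fderiv ℝ f x (Pi.single μ 1)

/-- The Minkowski gradient `grad p = (∂₁p, ∂₂p, ∂₃p, −∂₄p)`. -/
def mgrad (p : (Fin 4 → ℝ) → ℝ) (x : Fin 4 → ℝ) : Fin 4 → ℝ :=
  fun ν => etaCoef ν * pd ν p x

/-- The relativistic Euler equations for the triple `(U, ρ, p)` on `Ω`:
`(ρ+p)·Σ_μ U^μ ∂_μ U^ν + (grad p)^ν + η(grad p, U)·U^ν = 0`. -/
def EulerEqs (Ω : Set (Fin 4 → ℝ)) (U : (Fin 4 → ℝ) → Fin 4 → ℝ)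
    (ρ p : (Fin 4 → ℝ) → ℝ) : Prop :=
  ∀ x ∈ Ω, ∀ ν : Fin 4,
    (ρ x + p x) * (∑ μ, U x μ * pd μ (fun y => U y ν) x)
      + mgrad p x ν + eta (mgrad p x) (U x) * U x ν = 0

/-- Conservation of energy along flow lines:
`(ρ+p)·Σ_μ ∂_μ U^μ + Σ_μ U^μ ∂_μ ρ = 0` on `Ω`. -/
def EnergyCons (Ω : Set (Fin 4 → ℝ)) (U : (Fin 4 → ℝ) → Fin 4 → ℝ)
    (ρ p : (Fin 4 → ℝ) → ℝ) : Prop :=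
  ∀ x ∈ Ω,
    (ρ x + p x) * (∑ μ, pd μ (fun y => U y μ) x) + (∑ μ, U x μ * pd μ ρ x) = 0

/-- The interior of the forward light cone in Minkowski `ℝ⁴`. -/
def lightcone : Set (Fin 4 → ℝ) :=
  {x | Real.sqrt ((x 0) ^ 2 + (x 1) ^ 2 + (x 2) ^ 2) < x 3}

/-- `r² = x₁² + x₂² + x₃²`. -/
def rsq (x : Fin 4 → ℝ) : ℝ := (x 0) ^ 2 + (x 1) ^ 2 + (x 2) ^ 2

/-- The normalized Morawetz vector field
`U(x) = (2x₄x₁, 2x₄x₂, 2x₄x₃, x₄² + r²)/(x₄² − r²)`. -/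
def Umor (x : Fin 4 → ℝ) : Fin 4 → ℝ := fun ν =>
  (if ν = 3 then (x 3) ^ 2 + rsq x else 2 * x 3 * x ν) / ((x 3) ^ 2 - rsq x)

lemma sq_sub_rsq_pos {x : Fin 4 → ℝ} (hx : x ∈ lightcone) : 0 < (x 3) ^ 2 - rsq x :=
  sub_pos.2 (Real.lt_sq_of_sqrt_lt hx)

lemma hasFDerivAt_coord (i : Fin 4) (x : Fin 4 → ℝ) :
    HasFDerivAt (fun y : Fin 4 → ℝ => y i) (ContinuousLinearMap.proj (R := ℝ) i) x :=
  (ContinuousLinearMap.proj (R := ℝ) (φ := fun _ : Fin 4 => ℝ) i).hasFDerivAt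

lemma pd_coord (μ i : Fin 4) (x : Fin 4 → ℝ) :
    pd μ (fun y => y i) x = if i = μ then 1 else 0 := by
  simp [pd, (hasFDerivAt_coord i x).fderiv, Pi.single_apply]

lemma pd_add {f g : (Fin 4 → ℝ) → ℝ} {x : Fin 4 → ℝ} (μ : Fin 4)
    (hf : DifferentiableAt ℝ f x) (hg : DifferentiableAt ℝ g x) :
    pd μ (fun y => f y + g y) x = pd μ f x + pd μ g x := by
  simp [pd, fderiv_fun_add hf hg]

lemma pd_sub {f g : (Fin 4 → ℝ) → ℝ} {x : Fin 4 → ℝ} (μ : Fin 4)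
    (hf : DifferentiableAt ℝ f x) (hg : DifferentiableAt ℝ g x) :
    pd μ (fun y => f y - g y) x = pd μ f x - pd μ g x := by
  simp [pd, fderiv_fun_sub hf hg]

lemma pd_mul {f g : (Fin 4 → ℝ) → ℝ} {x : Fin 4 → ℝ} (μ : Fin 4)
    (hf : DifferentiableAt ℝ f x) (hg : DifferentiableAt ℝ g x) :
    pd μ (fun y => f y * g y) x = f x * pd μ g x + g x * pd μ f x := by
  simp [pd, fderiv_fun_mul hf hg]

lemma pd_pow {f : (Fin 4 → ℝ) → ℝ} {x : Fin 4 → ℝ} (μ : Fin 4) (n : ℕ)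
    (hf : DifferentiableAt ℝ f x) :
    pd μ (fun y => f y ^ n) x = n * f x ^ (n - 1) * pd μ f x := by
  simp [pd, fderiv_fun_pow n hf]

lemma pd_const_mul {f : (Fin 4 → ℝ) → ℝ} {x : Fin 4 → ℝ} (μ : Fin 4) (c : ℝ)
    (hf : DifferentiableAt ℝ f x) :
    pd μ (fun y => c * f y) x = c * pd μ f x := by
  simp [pd, fderiv_const_mul hf]

lemma pd_inv {f : (Fin 4 → ℝ) → ℝ} {x : Fin 4 → ℝ} (μ : Fin 4)
    (hf : DifferentiableAt ℝ f x) (h0 : f x ≠ 0) :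
    pd μ (fun y => (f y)⁻¹) x = -pd μ f x / f x ^ 2 := by
  have h := (hasDerivAt_inv h0).comp_hasFDerivAt x hf.hasFDerivAt
  have h' : fderiv ℝ (fun y => (f y)⁻¹) x = _ := h.fderiv
  simp only [pd, h', smul_apply, smul_eq_mul]
  ring

lemma pd_div {f g : (Fin 4 → ℝ) → ℝ} {x : Fin 4 → ℝ} (μ : Fin 4)
    (hf : DifferentiableAt ℝ f x) (hg : DifferentiableAt ℝ g x) (h0 : g x ≠ 0) :
    pd μ (fun y => f y / g y) x = (pd μ f x * g x - f x * pd μ g x) / g x ^ 2 := by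
  simp only [div_eq_mul_inv]
  rw [pd_mul μ hf (hg.fun_inv h0), pd_inv μ hg h0]
  field_simp
  ring

lemma differentiableAt_rsq (x : Fin 4 → ℝ) : DifferentiableAt ℝ rsq x := by
  unfold rsq
  fun_prop

lemma pd_rsq (μ : Fin 4) (x : Fin 4 → ℝ) :
    pd μ rsq x = if μ = 3 then 0 else 2 * x μ := by
  unfold rsq
  rw [pd_add μ (by fun_prop) (by fun_prop), pd_add μ (by fun_prop) (by fun_prop),
    pd_pow μ 2 (by fun_prop), pd_pow μ 2 (by fun_prop), pd_pow μ 2 (by fun_prop)]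
  fin_cases μ <;> simp [pd_coord]

lemma pd_sq_time (μ : Fin 4) (x : Fin 4 → ℝ) :
    pd μ (fun y => y 3 ^ 2) x = if μ = 3 then 2 * x 3 else 0 := by
  rw [pd_pow μ 2 (by fun_prop), pd_coord]
  fin_cases μ <;> simp

lemma pd_sq_sub_rsq (μ : Fin 4) (x : Fin 4 → ℝ) :
    pd μ (fun y => y 3 ^ 2 - rsq y) x = -2 * etaCoef μ * x μ := by
  rw [pd_sub μ (by fun_prop) (differentiableAt_rsq x), pd_rsq, pd_sq_time]
  by_cases h : μ = 3 <;> simp [h, etaCoef]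

lemma pd_density (μ : Fin 4) {x : Fin 4 → ℝ} (h0 : (x 3) ^ 2 - rsq x ≠ 0) :
    pd μ (fun y => ((y 3 ^ 2 - rsq y) ^ 4)⁻¹) x =
      8 * etaCoef μ * x μ / (x 3 ^ 2 - rsq x) ^ 5 := by
  have hd : DifferentiableAt ℝ (fun y : Fin 4 → ℝ => y 3 ^ 2 - rsq y) x :=
    .fun_sub (by fun_prop) (differentiableAt_rsq x)
  rw [pd_inv μ (hd.fun_pow 4) (pow_ne_zero 4 h0), pd_pow μ 4 hd, pd_sq_sub_rsq]
  field_simp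
  norm_num
  ring

lemma pd_pressure (μ : Fin 4) {x : Fin 4 → ℝ} (h0 : (x 3) ^ 2 - rsq x ≠ 0) :
    pd μ (fun y => ((y 3 ^ 2 - rsq y) ^ 4)⁻¹ / 3) x =
      8 / 3 * etaCoef μ * x μ / (x 3 ^ 2 - rsq x) ^ 5 := by
  have hd : DifferentiableAt ℝ (fun y : Fin 4 → ℝ => y 3 ^ 2 - rsq y) x :=
    .fun_sub (by fun_prop) (differentiableAt_rsq x)
  simp only [div_eq_inv_mul _ (3 : ℝ)]
  rw [pd_const_mul μ _ ((hd.fun_pow 4).fun_inv (pow_ne_zero 4 h0)), pd_density μ h0]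
  ring

lemma pd_Umor_time (μ : Fin 4) {x : Fin 4 → ℝ} (h0 : (x 3) ^ 2 - rsq x ≠ 0) :
    pd μ (fun y => Umor y 3) x =
      (2 * x μ * (x 3 ^ 2 - rsq x) + 2 * etaCoef μ * x μ * (x 3 ^ 2 + rsq x)) /
        (x 3 ^ 2 - rsq x) ^ 2 := by
  have hr := differentiableAt_rsq x
  simp only [Umor, if_true]
  rw [pd_div μ (.fun_add (by fun_prop) hr) (.fun_sub (by fun_prop) hr) h0, pd_sq_sub_rsq,
    pd_add μ (by fun_prop) hr, pd_rsq, pd_sq_time]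
  by_cases h : μ = 3 <;> simp [h] <;> ring

lemma pd_Umor_space (μ : Fin 4) {ν : Fin 4} (hν : ν ≠ 3) {x : Fin 4 → ℝ}
    (h0 : (x 3) ^ 2 - rsq x ≠ 0) :
    pd μ (fun y => Umor y ν) x =
      (2 * (x 3 * (if ν = μ then 1 else 0) + x ν * (if 3 = μ then 1 else 0)) *
          (x 3 ^ 2 - rsq x) + 4 * etaCoef μ * x μ * x 3 * x ν) /
        (x 3 ^ 2 - rsq x) ^ 2 := by
  simp only [Umor, if_neg hν, mul_assoc (2 : ℝ)]
  rw [pd_div μ (by fun_prop) (.fun_sub (by fun_prop) (differentiableAt_rsq x)) h0, pd_sq_sub_rsq,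
    pd_const_mul μ _ (by fun_prop), pd_mul μ (by fun_prop) (by fun_prop), pd_coord, pd_coord]
  ring

lemma eta_Umor_self {x : Fin 4 → ℝ} (h0 : (x 3) ^ 2 - rsq x ≠ 0) :
    eta (Umor x) (Umor x) = -1 := by
  simp [eta, Umor, Fin.sum_univ_four, etaCoef]
  field_simp
  simp only [rsq]
  ring

/-- the Morawetz flow with `ρ = (x₄² − r²)^{−4}` and the
radiation equation of state `p = ρ/3` solves the relativistic Euler equations
and the energy conservation equation on the forward light cone. -/
theorem statement13 :
    (∀ x ∈ lightcone, eta (Umor x) (Umor x) = -1) ∧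
    EulerEqs lightcone Umor (fun x => (((x 3) ^ 2 - rsq x) ^ 4)⁻¹)
      (fun x => (((x 3) ^ 2 - rsq x) ^ 4)⁻¹ / 3) ∧
    EnergyCons lightcone Umor (fun x => (((x 3) ^ 2 - rsq x) ^ 4)⁻¹)
      (fun x => (((x 3) ^ 2 - rsq x) ^ 4)⁻¹ / 3) := by
  have h0 {x : Fin 4 → ℝ} (hx : x ∈ lightcone) : (x 3) ^ 2 - rsq x ≠ 0 :=
    (sq_sub_rsq_pos hx).ne'
  refine ⟨fun x hx => eta_Umor_self (h0 hx), fun x hx ν => ?_, fun x hx => ?_⟩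
  · have hs := h0 hx
    by_cases hν : ν = 3
    · subst hν
      simp only [eta, mgrad, pd_pressure _ hs, pd_Umor_time _ hs]
      simp [Umor, Fin.sum_univ_four, etaCoef]
      field_simp
      simp only [rsq]
      ring
    · simp only [eta, mgrad, pd_pressure _ hs, pd_Umor_space _ hν hs]
      fin_cases ν <;> simp [Umor, Fin.sum_univ_four, etaCoef] at hν ⊢ <;>
      field_simp <;>
      simp only [rsq] <;>
      ring
  · have hs := h0 hx
    simp only [pd_density _ hs, Fin.sum_univ_four, pd_Umor_time _ hs,
      pd_Umor_space _ (show (0 : Fin 4) ≠ 3 by decide) hs,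
      pd_Umor_space _ (show (1 : Fin 4) ≠ 3 by decide) hs,
      pd_Umor_space _ (show (2 : Fin 4) ≠ 3 by decide) hs]
    simp [Umor, etaCoef]
    field_simp
    simp only [rsq]
    ring
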